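/- Let A be a regular Hopf coquasigroup over a field k with a faithful left integral φ. Then there exists a unique algebra automorphism σ of A such that φ(ab) = φ(b·σ(a)) for all a, b ∈ A; moreover φ(σ(a)) = φ(a) for all a ∈ A (φ is σ-invariant). -/

import Mathlib

open TensorProduct

/-- A regular Hopf coquasigroup over a field `k`: a unital associative `k`-algebra `A`
with a (not necessarily coassociative) coproduct `comul : A →ₐ[k] A ⊗[k] A`, a counit
`counit : A →ₐ[k] k`, and a bijective antipode `antipode : A ≃ₗ[k] A` which is
antimultiplicative, anticomultiplicative, and satisfies the quasigroup antipode
identities. -/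
structure RegularHopfCoquasigroup (k A : Type*) [Field k] [Ring A] [Algebra k A] where
  comul : A →ₐ[k] A ⊗[k] A
  counit : A →ₐ[k] k
  antipode : A ≃ₗ[k] A
  /-- `(ε ⊗ id) ∘ Δ = id` -/
  counit_comul_left : ∀ a : A,
    (TensorProduct.lid k A) ((LinearMap.rTensor A counit.toLinearMap) (comul a)) = a
  /-- `(id ⊗ ε) ∘ Δ = id` -/
  counit_comul_right : ∀ a : A,
    (TensorProduct.rid k A) ((LinearMap.lTensor A counit.toLinearMap) (comul a)) = a
  /-- `S(ab) = S(b)S(a)` -/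
  antipode_mul : ∀ a b : A, antipode (a * b) = antipode b * antipode a
  /-- `S(1) = 1` -/
  antipode_one : antipode (1 : A) = 1
  /-- `Δ ∘ S = (S ⊗ S) ∘ flip ∘ Δ` -/
  antipode_comul : ∀ a : A,
    comul (antipode a) =
      (TensorProduct.map antipode.toLinearMap antipode.toLinearMap)
        ((TensorProduct.comm k A A) (comul a))
  /-- `S(a₍₁₎)a₍₂₎₍₁₎ ⊗ a₍₂₎₍₂₎ = 1 ⊗ a` -/
  quasi₁ : ∀ a : A,
    (LinearMap.rTensor A (LinearMap.mul' k A))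
      ((TensorProduct.assoc k A A A).symm
        ((LinearMap.rTensor (A ⊗[k] A) antipode.toLinearMap)
          ((LinearMap.lTensor A comul.toLinearMap) (comul a)))) = (1 : A) ⊗ₜ[k] a
  /-- `a₍₁₎S(a₍₂₎₍₁₎) ⊗ a₍₂₎₍₂₎ = 1 ⊗ a` -/
  quasi₂ : ∀ a : A,
    (LinearMap.rTensor A (LinearMap.mul' k A))
      ((TensorProduct.assoc k A A A).symm
        ((LinearMap.lTensor A (LinearMap.rTensor A antipode.toLinearMap))
          ((LinearMap.lTensor A comul.toLinearMap) (comul a)))) = (1 : A) ⊗ₜ[k] a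
  /-- `a₍₁₎₍₁₎ ⊗ S(a₍₁₎₍₂₎)a₍₂₎ = a ⊗ 1` -/
  quasi₃ : ∀ a : A,
    (LinearMap.lTensor A (LinearMap.mul' k A))
      ((TensorProduct.assoc k A A A)
        ((LinearMap.rTensor A (LinearMap.lTensor A antipode.toLinearMap))
          ((LinearMap.rTensor A comul.toLinearMap) (comul a)))) = a ⊗ₜ[k] (1 : A)
  /-- `a₍₁₎₍₁₎ ⊗ a₍₁₎₍₂₎S(a₍₂₎) = a ⊗ 1` -/
  quasi₄ : ∀ a : A,
    (LinearMap.lTensor A (LinearMap.mul' k A))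
      ((TensorProduct.assoc k A A A)
        ((LinearMap.lTensor (A ⊗[k] A) antipode.toLinearMap)
          ((LinearMap.rTensor A comul.toLinearMap) (comul a)))) = a ⊗ₜ[k] (1 : A)

variable {k A : Type*} [Field k] [Ring A] [Algebra k A]

/-- `(id ⊗ f)` on `A ⊗[k] A`, composed with `A ⊗ k ≅ A`; so `idT f (a ⊗ b) = f b • a`,
i.e. in Sweedler notation `idT f (Δ a) = a₍₁₎ f(a₍₂₎)`. -/
noncomputable def idT (f : A →ₗ[k] k) : A ⊗[k] A →ₗ[k] A :=
  (TensorProduct.rid k A).toLinearMap ∘ₗ LinearMap.lTensor A f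

/-- `(f ⊗ id)` on `A ⊗[k] A`, composed with `k ⊗ A ≅ A`; so `Tid f (a ⊗ b) = f a • b`,
i.e. in Sweedler notation `Tid f (Δ a) = f(a₍₁₎) a₍₂₎`. -/
noncomputable def Tid (f : A →ₗ[k] k) : A ⊗[k] A →ₗ[k] A :=
  (TensorProduct.lid k A).toLinearMap ∘ₗ LinearMap.rTensor A f

/-- A linear functional `f` on `A` is faithful if `f(a·) = 0` implies `a = 0` and
`f(·a) = 0` implies `a = 0`. -/
def Faithful (f : A →ₗ[k] k) : Prop :=
  (∀ a : A, (∀ b : A, f (a * b) = 0) → a = 0) ∧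
  (∀ a : A, (∀ b : A, f (b * a) = 0) → a = 0)

/-- A left integral: a nonzero functional `φ` with `a₍₁₎ φ(a₍₂₎) = φ(a)·1`. -/
def IsLeftIntegral (H : RegularHopfCoquasigroup k A) (φ : A →ₗ[k] k) : Prop :=
  φ ≠ 0 ∧ ∀ a : A, idT φ (H.comul a) = φ a • (1 : A)

/-- A right integral: a nonzero functional `ψ` with `ψ(a₍₁₎) a₍₂₎ = ψ(a)·1`. -/
def IsRightIntegral (H : RegularHopfCoquasigroup k A) (ψ : A →ₗ[k] k) : Prop :=
  ψ ≠ 0 ∧ ∀ a : A, Tid ψ (H.comul a) = ψ a • (1 : A)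


@[simp]
lemma idT_tmul (f : A →ₗ[k] k) (a b : A) : idT f (a ⊗ₜ[k] b) = f b • a := by
  simp [idT]

@[simp]
lemma Tid_tmul (f : A →ₗ[k] k) (a b : A) : Tid f (a ⊗ₜ[k] b) = f a • b := by
  simp [Tid]

lemma idT_tmul_one_mul (f : A →ₗ[k] k) (u : A) (t : A ⊗[k] A) :
    idT f ((u ⊗ₜ[k] (1 : A)) * t) = u * idT f t := by
  induction t with
  | zero => simp
  | add x y hx hy => simp [mul_add, hx, hy]
  | tmul x y => simp

namespace RegularHopfCoquasigroup

variable (H : RegularHopfCoquasigroup k A)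

lemma antipode_symm_mul (a b : A) :
    H.antipode.symm (a * b) = H.antipode.symm b * H.antipode.symm a := by
  apply H.antipode.injective
  simp [H.antipode_mul]

lemma antipode_symm_one : H.antipode.symm (1 : A) = 1 := by
  rw [LinearEquiv.symm_apply_eq, H.antipode_one]

/-- Strong left invariance: `b₍₁₎ φ(a b₍₂₎) = S(a₍₁₎) φ(a₍₂₎ b)`. -/
lemma idT_one_tmul_mul_comul {φ : A →ₗ[k] k}
    (hφ : ∀ a : A, idT φ (H.comul a) = φ a • (1 : A)) (a b : A) :
    idT φ (((1 : A) ⊗ₜ[k] a) * H.comul b) =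
      H.antipode (idT φ (H.comul a * ((1 : A) ⊗ₜ[k] b))) := by
  rw [← H.quasi₁ a]
  generalize H.comul a = t
  induction t with
  | zero => simp
  | add x y hx hy => simp only [map_add, add_mul, hx, hy]
  | tmul u v =>
    have h : (LinearMap.rTensor A (LinearMap.mul' k A))
        ((TensorProduct.assoc k A A A).symm
          ((LinearMap.rTensor (A ⊗[k] A) H.antipode.toLinearMap)
            ((LinearMap.lTensor A H.comul.toLinearMap) (u ⊗ₜ[k] v)))) =
        (H.antipode u ⊗ₜ[k] (1 : A)) * H.comul v := by
      simp only [LinearMap.lTensor_tmul, LinearMap.rTensor_tmul, AlgHom.toLinearMap_apply]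
      generalize H.comul v = s
      induction s with
      | zero => simp
      | add x y hx hy => simp only [TensorProduct.tmul_add, map_add, mul_add, hx, hy]
      | tmul x y => simp
    rw [h, mul_assoc, ← map_mul, idT_tmul_one_mul, hφ]
    simp

/-- Strong right invariance of `ψ = φ ∘ S`: `S(ψ(d x₍₁₎) x₍₂₎) = ψ(d₍₁₎ x) d₍₂₎`. -/
lemma antipode_Tid_tmul_one_mul_comul {φ : A →ₗ[k] k}
    (hφ : ∀ a : A, idT φ (H.comul a) = φ a • (1 : A)) (d x : A) :
    H.antipode (Tid (φ ∘ₗ H.antipode.toLinearMap) ((d ⊗ₜ[k] (1 : A)) * H.comul x)) =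
      Tid (φ ∘ₗ H.antipode.toLinearMap) (H.comul d * (x ⊗ₜ[k] (1 : A))) := by
  have h₁ (t : A ⊗[k] A) :
      H.antipode (Tid (φ ∘ₗ H.antipode.toLinearMap) ((d ⊗ₜ[k] (1 : A)) * t)) =
        idT φ (TensorProduct.map H.antipode.toLinearMap H.antipode.toLinearMap
          (TensorProduct.comm k A A t) * ((1 : A) ⊗ₜ[k] H.antipode d)) := by
    induction t with
    | zero => simp
    | add x y hx hy => simp only [map_add, mul_add, add_mul, hx, hy]
    | tmul u v => simp [H.antipode_mul]
  have h₂ (t : A ⊗[k] A) :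
      idT φ (((1 : A) ⊗ₜ[k] H.antipode x) *
        TensorProduct.map H.antipode.toLinearMap H.antipode.toLinearMap
          (TensorProduct.comm k A A t)) =
        H.antipode (Tid (φ ∘ₗ H.antipode.toLinearMap) (t * (x ⊗ₜ[k] (1 : A)))) := by
    induction t with
    | zero => simp
    | add x y hx hy => simp only [map_add, mul_add, add_mul, hx, hy]
    | tmul u v => simp [H.antipode_mul]
  rw [h₁, ← H.antipode_comul]
  apply H.antipode.injective
  rw [← H.idT_one_tmul_mul_comul hφ, H.antipode_comul, h₂]

lemma apply_Tid_mul (φ ψ : A →ₗ[k] k) (a b : A) (t : A ⊗[k] A) :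
    φ (Tid ψ ((a ⊗ₜ[k] (1 : A)) * t) * b) = ψ (a * idT φ (t * ((1 : A) ⊗ₜ[k] b))) := by
  induction t with
  | zero => simp
  | add x y hx hy => simp only [map_add, mul_add, add_mul, hx, hy]
  | tmul u v => simp [mul_comm]

lemma apply_mul_Tid (φ ψ : A →ₗ[k] k) (a b : A) (t : A ⊗[k] A) :
    φ (b * Tid ψ ((a ⊗ₜ[k] (1 : A)) * t)) = ψ (a * idT φ (((1 : A) ⊗ₜ[k] b) * t)) := by
  induction t with
  | zero => simp
  | add x y hx hy => simp only [map_add, mul_add, hx, hy]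
  | tmul u v => simp [mul_comm]

/-- Both sides equal `ψ(a x₍₁₎) φ(x₍₂₎ b)`. -/
lemma apply_mul_Tid_eq {φ : A →ₗ[k] k}
    (hφ : ∀ a : A, idT φ (H.comul a) = φ a • (1 : A)) (a b x : A) :
    φ (x * Tid (φ ∘ₗ H.antipode.toLinearMap)
        ((a ⊗ₜ[k] (1 : A)) * LinearMap.rTensor A H.antipode.symm.toLinearMap (H.comul b))) =
      (φ ∘ₗ H.antipode.toLinearMap)
        (idT φ (LinearMap.lTensor A H.antipode.symm.toLinearMap (H.comul a) *
          ((1 : A) ⊗ₜ[k] b)) * x) := by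
  set ψ := φ ∘ₗ H.antipode.toLinearMap
  have h₁ (t : A ⊗[k] A) :
      idT φ (((1 : A) ⊗ₜ[k] x) * LinearMap.rTensor A H.antipode.symm.toLinearMap t) =
        H.antipode.symm (idT φ (((1 : A) ⊗ₜ[k] x) * t)) := by
    induction t with
    | zero => simp
    | add x y hx hy => simp only [map_add, mul_add, hx, hy]
    | tmul u v => simp
  have h₂ (t : A ⊗[k] A) :
      ψ (idT φ (LinearMap.lTensor A H.antipode.symm.toLinearMap t * ((1 : A) ⊗ₜ[k] b)) * x) =
        φ (H.antipode.symm (Tid ψ (t * (x ⊗ₜ[k] (1 : A)))) * b) := by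
    induction t with
    | zero => simp
    | add x y hx hy => simp only [map_add, add_mul, hx, hy]
    | tmul u v => simp [mul_comm]
  rw [apply_mul_Tid, h₁, h₂, H.idT_one_tmul_mul_comul hφ, LinearEquiv.symm_apply_apply,
    ← apply_Tid_mul, ← H.antipode_Tid_tmul_one_mul_comul hφ, LinearEquiv.symm_apply_apply]

/-- Both sides equal `ψ(a x₍₁₎) φ(b x₍₂₎)`. -/
lemma apply_Tid_mul_eq {φ : A →ₗ[k] k}
    (hφ : ∀ a : A, idT φ (H.comul a) = φ a • (1 : A)) (a b x : A) :
    φ (Tid (φ ∘ₗ H.antipode.toLinearMap)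
        ((a ⊗ₜ[k] (1 : A)) * LinearMap.rTensor A H.antipode.toLinearMap (H.comul b)) * x) =
      (φ ∘ₗ H.antipode.toLinearMap)
        (idT φ (((1 : A) ⊗ₜ[k] b) *
          LinearMap.lTensor A H.antipode.symm.toLinearMap (H.comul a)) * x) := by
  set ψ := φ ∘ₗ H.antipode.toLinearMap
  have h₁ (t : A ⊗[k] A) :
      idT φ (LinearMap.rTensor A H.antipode.toLinearMap t * ((1 : A) ⊗ₜ[k] x)) =
        H.antipode (idT φ (t * ((1 : A) ⊗ₜ[k] x))) := by
    induction t with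
    | zero => simp
    | add x y hx hy => simp only [map_add, add_mul, hx, hy]
    | tmul u v => simp
  have h₂ (t : A ⊗[k] A) :
      ψ (idT φ (((1 : A) ⊗ₜ[k] b) * LinearMap.lTensor A H.antipode.symm.toLinearMap t) * x) =
        φ (b * H.antipode.symm (Tid ψ (t * (x ⊗ₜ[k] (1 : A))))) := by
    induction t with
    | zero => simp
    | add x y hx hy => simp only [map_add, mul_add, add_mul, hx, hy]
    | tmul u v => simp [mul_comm]
  rw [apply_Tid_mul, h₁, h₂, ← H.idT_one_tmul_mul_comul hφ,
    ← apply_mul_Tid, ← H.antipode_Tid_tmul_one_mul_comul hφ, LinearEquiv.symm_apply_apply]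

section Span

variable (N : Submodule k (A ⊗[k] A))

/-- The elements `a S(b₍₁₎) ⊗ b₍₂₎` span `A ⊗ A`. -/
lemma eq_top_of_tmul_one_mul_rTensor_antipode
    (h : ∀ a b : A,
      (a ⊗ₜ[k] (1 : A)) * LinearMap.rTensor A H.antipode.toLinearMap (H.comul b) ∈ N) :
    N = ⊤ := by
  rw [eq_top_iff, ← TensorProduct.span_tmul_eq_top, Submodule.span_le]
  rintro _ ⟨p, q, rfl⟩
  have key : p ⊗ₜ[k] q = (p ⊗ₜ[k] (1 : A)) * ((1 : A) ⊗ₜ[k] q) := by simp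
  rw [SetLike.mem_coe, key, ← H.quasi₂ q]
  generalize H.comul q = t
  induction t with
  | zero => simp
  | add x y hx hy => simpa only [map_add, mul_add] using N.add_mem hx hy
  | tmul u v =>
    convert h (p * u) v using 1
    simp only [LinearMap.lTensor_tmul, AlgHom.toLinearMap_apply]
    generalize H.comul v = s
    induction s with
    | zero => simp
    | add x y hx hy => simp only [TensorProduct.tmul_add, map_add, mul_add, hx, hy]
    | tmul x y => simp [mul_assoc]

/-- The elements `a S⁻¹(b₍₁₎) ⊗ b₍₂₎` span `A ⊗ A`. -/
lemma eq_top_of_tmul_one_mul_rTensor_antipode_symm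
    (h : ∀ a b : A,
      (a ⊗ₜ[k] (1 : A)) * LinearMap.rTensor A H.antipode.symm.toLinearMap (H.comul b) ∈ N) :
    N = ⊤ := by
  rw [eq_top_iff, ← TensorProduct.span_tmul_eq_top, Submodule.span_le]
  rintro _ ⟨p, q, rfl⟩
  have key : p ⊗ₜ[k] q = (p ⊗ₜ[k] (1 : A)) *
      LinearMap.rTensor A (H.antipode.symm.toLinearMap ∘ₗ H.antipode.symm.toLinearMap)
        ((1 : A) ⊗ₜ[k] q) := by simp [H.antipode_symm_one]
  rw [SetLike.mem_coe, key, ← H.quasi₂ q]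
  generalize H.comul q = t
  induction t with
  | zero => simp
  | add x y hx hy => simpa only [map_add, mul_add] using N.add_mem hx hy
  | tmul u v =>
    convert h (p * H.antipode.symm (H.antipode.symm u)) v using 1
    simp only [LinearMap.lTensor_tmul, AlgHom.toLinearMap_apply]
    generalize H.comul v = s
    induction s with
    | zero => simp
    | add x y hx hy => simp only [TensorProduct.tmul_add, map_add, mul_add, hx, hy]
    | tmul x y => simp [mul_assoc, H.antipode_symm_mul]

/-- The elements `a₍₁₎ ⊗ S⁻¹(a₍₂₎) b` span `A ⊗ A`. -/
lemma eq_top_of_lTensor_antipode_symm_mul_one_tmul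
    (h : ∀ a b : A,
      LinearMap.lTensor A H.antipode.symm.toLinearMap (H.comul a) * ((1 : A) ⊗ₜ[k] b) ∈ N) :
    N = ⊤ := by
  rw [eq_top_iff, ← TensorProduct.span_tmul_eq_top, Submodule.span_le]
  rintro _ ⟨p, q, rfl⟩
  have key : p ⊗ₜ[k] q =
      LinearMap.lTensor A (H.antipode.symm.toLinearMap ∘ₗ H.antipode.symm.toLinearMap)
        (p ⊗ₜ[k] (1 : A)) * ((1 : A) ⊗ₜ[k] q) := by simp [H.antipode_symm_one]
  rw [SetLike.mem_coe, key, ← H.quasi₃ p]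
  generalize H.comul p = t
  induction t with
  | zero => simp
  | add x y hx hy => simpa only [map_add, add_mul] using N.add_mem hx hy
  | tmul u v =>
    convert h u (H.antipode.symm (H.antipode.symm v) * q) using 1
    simp only [LinearMap.rTensor_tmul, AlgHom.toLinearMap_apply]
    generalize H.comul u = s
    induction s with
    | zero => simp
    | add x y hx hy => simp only [TensorProduct.add_tmul, map_add, add_mul, hx, hy]
    | tmul x y => simp [mul_assoc, H.antipode_symm_mul]

/-- The elements `a₍₁₎ ⊗ b S⁻¹(a₍₂₎)` span `A ⊗ A`. -/
lemma eq_top_of_one_tmul_mul_lTensor_antipode_symm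
    (h : ∀ a b : A,
      ((1 : A) ⊗ₜ[k] b) * LinearMap.lTensor A H.antipode.symm.toLinearMap (H.comul a) ∈ N) :
    N = ⊤ := by
  rw [eq_top_iff, ← TensorProduct.span_tmul_eq_top, Submodule.span_le]
  rintro _ ⟨p, q, rfl⟩
  have key : p ⊗ₜ[k] q = ((1 : A) ⊗ₜ[k] q) *
      LinearMap.lTensor A H.antipode.symm.toLinearMap (p ⊗ₜ[k] (1 : A)) := by
    simp [H.antipode_symm_one]
  rw [SetLike.mem_coe, key, ← H.quasi₄ p]
  generalize H.comul p = t
  induction t with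
  | zero => simp
  | add x y hx hy => simpa only [map_add, mul_add] using N.add_mem hx hy
  | tmul u v =>
    convert h u (q * v) using 1
    simp only [LinearMap.rTensor_tmul, AlgHom.toLinearMap_apply]
    generalize H.comul u = s
    induction s with
    | zero => simp
    | add x y hx hy => simp only [TensorProduct.add_tmul, map_add, mul_add, hx, hy]
    | tmul x y => simp [mul_assoc, H.antipode_symm_mul]

end Span

end RegularHopfCoquasigroup

lemma Tid_surjective {f : A →ₗ[k] k} (hf : f ≠ 0) :
    Function.Surjective (Tid f) := fun a ↦ by
  obtain ⟨p, hp⟩ := LinearMap.surjective hf 1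
  exact ⟨p ⊗ₜ[k] a, by simp [hp]⟩

lemma idT_surjective {f : A →ₗ[k] k} (hf : f ≠ 0) :
    Function.Surjective (idT f) := fun a ↦ by
  obtain ⟨p, hp⟩ := LinearMap.surjective hf 1
  exact ⟨a ⊗ₜ[k] p, by simp [hp]⟩

lemma forall_mem_of_comap_eq_top {f : A ⊗[k] A →ₗ[k] A} (hf : Function.Surjective f)
    {M : Submodule k A} (hM : M.comap f = ⊤) (a : A) : a ∈ M := by
  obtain ⟨t, rfl⟩ := hf a
  exact hM.ge (Submodule.mem_top (x := t))

/-- The linear map sending `a` to the functional `f(a ·)`. -/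
noncomputable def leftMulFunctional (f : A →ₗ[k] k) : A →ₗ[k] A →ₗ[k] k :=
  (LinearMap.mul k A).compr₂ f

/-- The linear map sending `a` to the functional `f(· a)`. -/
noncomputable def rightMulFunctional (f : A →ₗ[k] k) : A →ₗ[k] A →ₗ[k] k :=
  (LinearMap.mul k A).flip.compr₂ f

namespace IsLeftIntegral

variable {H : RegularHopfCoquasigroup k A} {φ : A →ₗ[k] k}

lemma comp_antipode_ne_zero (hφ : IsLeftIntegral H φ) :
    φ ∘ₗ H.antipode.toLinearMap ≠ 0 := fun h ↦ hφ.1 <| by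
  ext a
  simpa using LinearMap.congr_fun h (H.antipode.symm a)

lemma range_leftMulFunctional_comp_antipode (hφ : IsLeftIntegral H φ) :
    LinearMap.range (leftMulFunctional φ) =
      LinearMap.range (leftMulFunctional (φ ∘ₗ H.antipode.toLinearMap)) := by
  apply le_antisymm
  · rintro _ ⟨c, rfl⟩
    exact forall_mem_of_comap_eq_top (Tid_surjective hφ.comp_antipode_ne_zero)
      (M := (LinearMap.range (leftMulFunctional (φ ∘ₗ H.antipode.toLinearMap))).comap
        (leftMulFunctional φ))
      (H.eq_top_of_tmul_one_mul_rTensor_antipode _ fun a b ↦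
        ⟨_, LinearMap.ext fun x ↦ (H.apply_Tid_mul_eq hφ.2 a b x).symm⟩) c
  · rintro _ ⟨d, rfl⟩
    exact forall_mem_of_comap_eq_top (idT_surjective hφ.1)
      (M := (LinearMap.range (leftMulFunctional φ)).comap
        (leftMulFunctional (φ ∘ₗ H.antipode.toLinearMap)))
      (H.eq_top_of_one_tmul_mul_lTensor_antipode_symm _ fun a b ↦
        ⟨_, LinearMap.ext fun x ↦ H.apply_Tid_mul_eq hφ.2 a b x⟩) d

lemma range_rightMulFunctional_comp_antipode (hφ : IsLeftIntegral H φ) :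
    LinearMap.range (rightMulFunctional φ) =
      LinearMap.range (leftMulFunctional (φ ∘ₗ H.antipode.toLinearMap)) := by
  apply le_antisymm
  · rintro _ ⟨c, rfl⟩
    exact forall_mem_of_comap_eq_top (Tid_surjective hφ.comp_antipode_ne_zero)
      (M := (LinearMap.range (leftMulFunctional (φ ∘ₗ H.antipode.toLinearMap))).comap
        (rightMulFunctional φ))
      (H.eq_top_of_tmul_one_mul_rTensor_antipode_symm _ fun a b ↦
        ⟨_, LinearMap.ext fun x ↦ (H.apply_mul_Tid_eq hφ.2 a b x).symm⟩) c
  · rintro _ ⟨d, rfl⟩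
    exact forall_mem_of_comap_eq_top (idT_surjective hφ.1)
      (M := (LinearMap.range (rightMulFunctional φ)).comap
        (leftMulFunctional (φ ∘ₗ H.antipode.toLinearMap)))
      (H.eq_top_of_lTensor_antipode_symm_mul_one_tmul _ fun a b ↦
        ⟨_, LinearMap.ext fun x ↦ H.apply_mul_Tid_eq hφ.2 a b x⟩) d

end IsLeftIntegral

namespace Faithful

variable {f : A →ₗ[k] k}

lemma leftMulFunctional_injective (hf : Faithful f) :
    Function.Injective (leftMulFunctional f) := by
  rw [injective_iff_map_eq_zero]
  exact fun a ha ↦ hf.1 a fun b ↦ LinearMap.congr_fun ha b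

lemma rightMulFunctional_injective (hf : Faithful f) :
    Function.Injective (rightMulFunctional f) := by
  rw [injective_iff_map_eq_zero]
  exact fun a ha ↦ hf.2 a fun b ↦ LinearMap.congr_fun ha b

lemma eq_of_apply_mul_left_eq (hf : Faithful f) {a b : A}
    (h : ∀ c, f (c * a) = f (c * b)) : a = b :=
  hf.rightMulFunctional_injective (LinearMap.ext h)

/-- A faithful functional whose left and right translates agree has a modular automorphism. -/
lemma exists_algEquiv_apply_mul (hf : Faithful f)
    (h : LinearMap.range (leftMulFunctional f) = LinearMap.range (rightMulFunctional f)) :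
    ∃ σ : A ≃ₐ[k] A, ∀ a b : A, f (a * b) = f (b * σ a) := by
  let e : A ≃ₗ[k] A := (LinearEquiv.ofInjective _ hf.leftMulFunctional_injective).trans
    ((LinearEquiv.ofEq _ _ h).trans
      (LinearEquiv.ofInjective _ hf.rightMulFunctional_injective).symm)
  have he (a b : A) : f (a * b) = f (b * e a) := by
    have h₁ : LinearEquiv.ofInjective _ hf.rightMulFunctional_injective (e a) =
        LinearEquiv.ofEq _ _ h (LinearEquiv.ofInjective _ hf.leftMulFunctional_injective a) := by
      simp [e]
    exact (LinearMap.congr_fun (congrArg Subtype.val h₁) b).symm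
  refine ⟨AlgEquiv.ofLinearEquiv e ?_ ?_, he⟩
  · exact hf.eq_of_apply_mul_left_eq fun c ↦ by rw [← he, one_mul, mul_one]
  · intro a b
    exact hf.eq_of_apply_mul_left_eq fun c ↦ by
      rw [← he, mul_assoc, he, mul_assoc, he, mul_assoc]

end Faithful

/-- existence and uniqueness of the modular automorphism `σ` with
`φ(ab) = φ(b σ(a))`; moreover `φ ∘ σ = φ`. -/
theorem stmt_12 (k A : Type*) [Field k] [Ring A] [Algebra k A]
    (H : RegularHopfCoquasigroup k A) (φ : A →ₗ[k] k)
    (hφ : IsLeftIntegral H φ) (hf : Faithful φ) :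
    (∃! σ : A ≃ₐ[k] A, ∀ a b : A, φ (a * b) = φ (b * σ a)) ∧
    ∀ σ : A ≃ₐ[k] A, (∀ a b : A, φ (a * b) = φ (b * σ a)) →
      ∀ a : A, φ (σ a) = φ a := by
  refine ⟨?_, fun σ hσ a ↦ by simpa using (hσ a 1).symm⟩
  obtain ⟨σ, hσ⟩ := hf.exists_algEquiv_apply_mul
    (hφ.range_leftMulFunctional_comp_antipode.trans
      hφ.range_rightMulFunctional_comp_antipode.symm)
  refine ⟨σ, hσ, fun τ hτ ↦ AlgEquiv.ext fun a ↦ hf.eq_of_apply_mul_left_eq fun b ↦ ?_⟩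
  rw [← hτ, hσ]
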